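/- arXiv:2206.15424 — 7 statements merged into one kernel-verified Lean document; each statement's English description precedes it below -/
import Mathlib

section
/- Let G be a connected graph containing three distinct vertices u, v, w that are pairwise true twins or pairwise false twins, and let k ≥ 1 be an integer. Then G has a resolving set of size at most k if and only if the graph G − u obtained by deleting the vertex u has a resolving set of size at most k − 1. -/
open SimpleGraph

variable {V : Type*}

/-- Two distinct vertices are true twins if they have equal closed neighborhoods. -/
def TrueTwins (G : SimpleGraph V) (u v : V) : Prop :=
  u ≠ v ∧ insert u (G.neighborSet u) = insert v (G.neighborSet v)

/-- Two distinct vertices are false twins if they have equal open neighborhoods. -/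
def FalseTwins (G : SimpleGraph V) (u v : V) : Prop :=
  u ≠ v ∧ G.neighborSet u = G.neighborSet v

/-- A set `S` is a resolving set of `G`. -/
def IsResolving {W : Type*} (G : SimpleGraph W) (S : Set W) : Prop :=
  ∀ u v : W, u ≠ v → ∃ w ∈ S, G.dist w u ≠ G.dist w v

/-- A graph is a cluster graph: every connected component is a clique. -/
def IsClusterGraph {W : Type*} (H : SimpleGraph W) : Prop :=
  ∀ a b : W, H.Reachable a b → a = b ∨ H.Adj a b

/-- `X` is a cluster modulator of `G`: `G - X` is a cluster graph. -/
def IsClusterModulator (G : SimpleGraph V) (X : Set V) : Prop :=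
  IsClusterGraph (G.induce Xᶜ)

/-- `C` is a clique of `G - X`, i.e. a connected component of `G - X`
(which is a clique when `X` is a cluster modulator). -/
def IsCliqueComponent (G : SimpleGraph V) (X C : Set V) : Prop :=
  C.Nonempty ∧ C ⊆ Xᶜ ∧ (∀ a ∈ C, ∀ b ∈ C, a ≠ b → G.Adj a b) ∧
    (∀ a ∈ C, ∀ b : V, b ∉ X → G.Adj a b → b ∈ C)

/-- Two vertices are clones (w.r.t. the modulator `X`) if they have the same
neighborhood in `X`. -/
def Clones (G : SimpleGraph V) (X : Set V) (u v : V) : Prop :=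
  G.neighborSet u ∩ X = G.neighborSet v ∩ X

/-- Two cliques of `G - X` are identical if their signatures (multisets of
neighborhoods in `X`) coincide, i.e. there is a bijection matching vertices
with equal neighborhoods in `X`. -/
def Identical (G : SimpleGraph V) (X C1 C2 : Set V) : Prop :=
  ∃ f : ↥C1 ≃ ↥C2, ∀ u : ↥C1, G.neighborSet (↑(f u)) ∩ X = G.neighborSet (↑u) ∩ X

/-- `𝒞` is an equivalence class of identical cliques of `G - X`:
a maximal set of pairwise identical cliques of `G - X`. -/
def IsIdenticalClass (G : SimpleGraph V) (X : Set V) (𝒞 : Set (Set V)) : Prop :=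
  (∀ C ∈ 𝒞, IsCliqueComponent G X C) ∧
  (∀ C1 ∈ 𝒞, ∀ C2 ∈ 𝒞, Identical G X C1 C2) ∧
  (∀ C, IsCliqueComponent G X C → (∃ C' ∈ 𝒞, Identical G X C C') → C ∈ 𝒞)

/-- The number of unordered pairs of true twins of `G` contained in `C`. -/
noncomputable def twinPairCount (G : SimpleGraph V) (C : Set V) : ℕ :=
  {p : Set V | ∃ u ∈ C, ∃ v ∈ C, TrueTwins G u v ∧ p = {u, v}}.ncard

/-- No three distinct vertices of `G` are pairwise true twins. -/
def NoThreeTrueTwins (G : SimpleGraph V) : Prop :=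
  ¬ ∃ u v w : V, TrueTwins G u v ∧ TrueTwins G u w ∧ TrueTwins G v w

/-- No three distinct vertices of `G` are pairwise false twins. -/
def NoThreeFalseTwins (G : SimpleGraph V) : Prop :=
  ¬ ∃ u v w : V, FalseTwins G u v ∧ FalseTwins G u w ∧ FalseTwins G v w

/-- `I` is an independent set of `G - X` corresponding to a connected component
of the complement of `G - X`. -/
def IsCoComponent (G : SimpleGraph V) (X I : Set V) : Prop :=
  I.Nonempty ∧ I ⊆ Xᶜ ∧ (∀ a ∈ I, ∀ b ∈ I, a ≠ b → ¬ G.Adj a b) ∧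
    (∀ a ∈ I, ∀ b : V, b ∉ X → a ≠ b → ¬ G.Adj a b → b ∈ I)

/-- Two vertices have the same neighbors among the remaining vertices. -/
def SameOuterNeighbors (G : SimpleGraph V) (u v : V) : Prop :=
  ∀ a, a ≠ u → a ≠ v → (G.Adj u a ↔ G.Adj v a)

theorem SameOuterNeighbors.symm {G : SimpleGraph V} {u v : V} (h : SameOuterNeighbors G u v) :
    SameOuterNeighbors G v u :=
  fun a hv hu => (h a hu hv).symm

theorem TrueTwins.sameOuterNeighbors {G : SimpleGraph V} {u v : V} (h : TrueTwins G u v) :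
    SameOuterNeighbors G u v := by
  intro a hu hv
  have := Set.ext_iff.1 h.2 a
  simpa [hu, hv] using this

theorem FalseTwins.sameOuterNeighbors {G : SimpleGraph V} {u v : V} (h : FalseTwins G u v) :
    SameOuterNeighbors G u v := by
  intro a _ _
  simpa using Set.ext_iff.1 h.2 a

/-- A map sending every edge to an edge or to a single vertex sends walks to walks that are
no longer. -/
theorem exists_walk_map_length_le {W : Type*} {G : SimpleGraph V} {H : SimpleGraph W} {f : V → W}
    (hf : ∀ a b, G.Adj a b → f a = f b ∨ H.Adj (f a) (f b)) {a b : V} (p : G.Walk a b) :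
    ∃ q : H.Walk (f a) (f b), q.length ≤ p.length := by
  induction p with
  | nil => exact ⟨Walk.nil, le_rfl⟩
  | cons hab p ih =>
    obtain ⟨q, hq⟩ := ih
    rcases hf _ _ hab with h | h
    · exact ⟨q.copy h.symm rfl, by simp; omega⟩
    · exact ⟨Walk.cons h q, by simpa using hq⟩

/-- A map sending every edge to an edge or to a single vertex does not increase distances. -/
theorem dist_map_le {W : Type*} {G : SimpleGraph V} {H : SimpleGraph W} {f : V → W}
    (hf : ∀ a b, G.Adj a b → f a = f b ∨ H.Adj (f a) (f b)) {a b : V} (hab : G.Reachable a b) :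
    H.dist (f a) (f b) ≤ G.dist a b := by
  obtain ⟨p, hp⟩ := hab.exists_walk_length_eq_dist
  obtain ⟨q, hq⟩ := exists_walk_map_length_le hf p
  exact (dist_le q).trans (hq.trans hp.le)

theorem SameOuterNeighbors.retraction_adj {G : SimpleGraph V} {u v : V} [DecidableEq V]
    (h : SameOuterNeighbors G u v) (a b : V) (hab : G.Adj a b) :
    (if a = u then v else a) = (if b = u then v else b) ∨
      G.Adj (if a = u then v else a) (if b = u then v else b) := by
  split_ifs with ha hb hb
  · exact .inl rfl
  · subst ha
    rcases eq_or_ne b v with rfl | hv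
    · exact .inl rfl
    · exact .inr ((h b hb hv).1 hab)
  · subst hb
    rcases eq_or_ne a v with rfl | hv
    · exact .inl rfl
    · exact .inr ((h a ha hv).1 hab.symm).symm
  · exact .inr hab

theorem SameOuterNeighbors.dist_le_dist {G : SimpleGraph V} {u v : V} (hG : G.Connected)
    (h : SameOuterNeighbors G u v) {x : V} (hu : x ≠ u) : G.dist v x ≤ G.dist u x := by
  classical
  simpa [hu] using dist_map_le h.retraction_adj (hG u x)

theorem SameOuterNeighbors.dist_eq {G : SimpleGraph V} {u v : V} (hG : G.Connected)
    (h : SameOuterNeighbors G u v) {x : V} (hu : x ≠ u) (hv : x ≠ v) :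
    G.dist u x = G.dist v x :=
  le_antisymm (h.symm.dist_le_dist hG hv) (h.dist_le_dist hG hu)

/-- Deleting a vertex that has a twin preserves the distances between the other vertices. -/
theorem SameOuterNeighbors.dist_induce_compl {G : SimpleGraph V} {u v : V} (hG : G.Connected)
    (h : SameOuterNeighbors G u v) (huv : u ≠ v) (x y : ↥({u}ᶜ : Set V)) :
    (G.induce ({u}ᶜ : Set V)).dist x y = G.dist x y := by
  classical
  let f : V → ↥({u}ᶜ : Set V) := fun a => ⟨if a = u then v else a, by
    by_cases ha : a = u <;> simp [ha, huv.symm]⟩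
  have hf : ∀ x : ↥({u}ᶜ : Set V), f x = x := fun x => Subtype.ext (if_neg x.2)
  have hle : (G.induce ({u}ᶜ : Set V)).dist (f x) (f y) ≤ G.dist x y :=
    dist_map_le (fun a b hab => (h.retraction_adj a b hab).imp (fun e => Subtype.ext e) id) (hG x y)
  have hreach : (G.induce ({u}ᶜ : Set V)).Reachable (f x) (f y) := by
    obtain ⟨p⟩ := hG x y
    obtain ⟨q, -⟩ := exists_walk_map_length_le (H := G.induce ({u}ᶜ : Set V)) (f := f)
      (fun a b hab => (h.retraction_adj a b hab).imp (fun e => Subtype.ext e) id) p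
    exact ⟨q⟩
  rw [hf, hf] at hle hreach
  exact le_antisymm hle
    (dist_map_le (f := Subtype.val) (fun _ _ hab => .inr hab) hreach)

theorem IsResolving.mem_or_mem {G : SimpleGraph V} {S : Set V} {u v : V} (hG : G.Connected)
    (hS : IsResolving G S) (h : SameOuterNeighbors G u v) (huv : u ≠ v) : u ∈ S ∨ v ∈ S := by
  obtain ⟨s, hs, hne⟩ := hS u v huv
  by_contra! hn
  refine hne ?_
  rw [dist_comm, h.dist_eq hG (fun e => hn.1 (e ▸ hs)) (fun e => hn.2 (e ▸ hs)), dist_comm]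

/-- A pair avoiding `p` that is resolved by `p` is also resolved by any twin of `p`. -/
theorem SameOuterNeighbors.dist_ne {G : SimpleGraph V} {p q x y : V} (hG : G.Connected)
    (h : SameOuterNeighbors G p q) (hx : x ≠ p) (hy : y ≠ p)
    (hne : G.dist p x ≠ G.dist p y) : G.dist q x ≠ G.dist q y := by
  have hxy : x ≠ y := fun e => hne (by rw [e])
  rcases eq_or_ne x q with rfl | hxq
  · rw [SimpleGraph.dist_self]
    exact (hG.pos_dist_of_ne hxy).ne
  rcases eq_or_ne y q with rfl | hyq
  · rw [SimpleGraph.dist_self]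
    exact (hG.pos_dist_of_ne hxy.symm).ne'
  rwa [← h.dist_eq hG hx hxq, ← h.dist_eq hG hy hyq]

theorem IsResolving.exists_diff_singleton {G : SimpleGraph V} {S : Set V} {p q x y : V}
    (hG : G.Connected) (hS : IsResolving G S) (h : SameOuterNeighbors G p q) (hpq : p ≠ q)
    (hq : q ∈ S) (hx : x ≠ p) (hy : y ≠ p) (hxy : x ≠ y) :
    ∃ s ∈ S \ {p}, G.dist s x ≠ G.dist s y := by
  obtain ⟨s, hs, hne⟩ := hS x y hxy
  by_cases hsp : s = p
  · subst hsp
    exact ⟨q, ⟨hq, hpq.symm⟩, h.dist_ne hG hx hy hne⟩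
  · exact ⟨s, ⟨hs, hsp⟩, hne⟩

/-- If `u ∉ S`, replacing `v` by its twin `u` in a pair resolved by `S` shows that `S \ {v}`
also resolves the pairs containing `v`, as long as they avoid `u`. -/
theorem IsResolving.exists_diff_singleton_left {G : SimpleGraph V} {S : Set V} {u v w y : V}
    (hG : G.Connected) (hS : IsResolving G S) (huv : SameOuterNeighbors G u v)
    (hvw : SameOuterNeighbors G v w)
    (huv' : u ≠ v) (hvw' : v ≠ w) (hu : u ∉ S) (hw : w ∈ S)
    (hyu : y ≠ u) (hyv : y ≠ v) :
    ∃ s ∈ S \ {v}, G.dist s v ≠ G.dist s y := by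
  obtain ⟨s, ⟨hs, hsv⟩, hne⟩ :=
    hS.exists_diff_singleton hG hvw hvw' hw huv' hyv hyu.symm
  refine ⟨s, ⟨hs, hsv⟩, ?_⟩
  rwa [dist_comm (v := v), ← huv.dist_eq hG (fun e => hu (e ▸ hs)) hsv, dist_comm]

theorem IsResolving.induce_compl {G : SimpleGraph V} {S : Set V} {u v : V}
    (hG : G.Connected) (huv : SameOuterNeighbors G u v) (huv' : u ≠ v)
    (hS : ∀ x y, x ≠ u → y ≠ u → x ≠ y → ∃ s ∈ S, s ≠ u ∧ G.dist s x ≠ G.dist s y) :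
    IsResolving (G.induce ({u}ᶜ : Set V)) (Subtype.val ⁻¹' S) := by
  intro x y hxy
  obtain ⟨s, hs, hsu, hne⟩ := hS x y x.2 y.2 (fun e => hxy (Subtype.ext e))
  refine ⟨⟨s, hsu⟩, hs, ?_⟩
  rwa [huv.dist_induce_compl hG huv', huv.dist_induce_compl hG huv']

theorem IsResolving.insert_image {G : SimpleGraph V} {u v : V} {S : Set ↥({u}ᶜ : Set V)}
    (hG : G.Connected) (huv : SameOuterNeighbors G u v) (huv' : u ≠ v)
    (hS : IsResolving (G.induce ({u}ᶜ : Set V)) S) :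
    IsResolving G (insert u (Subtype.val '' S)) := by
  intro x y hxy
  rcases eq_or_ne x u with rfl | hx
  · exact ⟨x, Set.mem_insert _ _, by rw [SimpleGraph.dist_self]; exact (hG.pos_dist_of_ne hxy).ne⟩
  rcases eq_or_ne y u with rfl | hy
  · exact ⟨y, Set.mem_insert _ _, by rw [SimpleGraph.dist_self]; exact (hG.pos_dist_of_ne hxy.symm).ne'⟩
  obtain ⟨s, hs, hne⟩ := hS ⟨x, hx⟩ ⟨y, hy⟩ (fun e => hxy (congrArg Subtype.val e))
  rw [huv.dist_induce_compl hG huv', huv.dist_induce_compl hG huv'] at hne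
  exact ⟨s, Set.mem_insert_of_mem _ ⟨s, hs, rfl⟩, hne⟩

/-- If `u`, `v`, `w` are pairwise twins, some vertex can be removed from any resolving set of `G`
to obtain a resolving set of `G - u`. -/
theorem IsResolving.exists_induce_compl {G : SimpleGraph V} {S : Set V} {u v w : V}
    (hG : G.Connected) (hS : IsResolving G S) (huv : SameOuterNeighbors G u v)
    (huw : SameOuterNeighbors G u w) (hvw : SameOuterNeighbors G v w)
    (huv' : u ≠ v) (huw' : u ≠ w) (hvw' : v ≠ w) :
    ∃ p ∈ S, IsResolving (G.induce ({u}ᶜ : Set V)) (Subtype.val ⁻¹' (S \ {p})) := by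
  by_cases hu : u ∈ S
  · obtain ⟨q, hq, huq, huq'⟩ : ∃ q ∈ S, SameOuterNeighbors G u q ∧ u ≠ q :=
      (hS.mem_or_mem hG hvw hvw').elim (fun h => ⟨v, h, huv, huv'⟩) (fun h => ⟨w, h, huw, huw'⟩)
    refine ⟨u, hu, IsResolving.induce_compl hG huv huv' fun x y hx hy hxy => ?_⟩
    obtain ⟨s, hs, hne⟩ := hS.exists_diff_singleton hG huq huq' hq hx hy hxy
    exact ⟨s, hs, hs.2, hne⟩
  · have hv : v ∈ S := (hS.mem_or_mem hG huv huv').resolve_left hu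
    have hw : w ∈ S := (hS.mem_or_mem hG huw huw').resolve_left hu
    refine ⟨v, hv, IsResolving.induce_compl hG huv huv' fun x y hx hy hxy => ?_⟩
    obtain ⟨s, hs, hne⟩ : ∃ s ∈ S \ {v}, G.dist s x ≠ G.dist s y := by
      rcases eq_or_ne x v with rfl | hxv
      · exact hS.exists_diff_singleton_left hG huv hvw huv' hvw' hu hw hy hxy.symm
      rcases eq_or_ne y v with rfl | hyv
      · obtain ⟨s, hs, hne⟩ :=
          hS.exists_diff_singleton_left hG huv hvw huv' hvw' hu hw hx hxy
        exact ⟨s, hs, hne.symm⟩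
      · exact hS.exists_diff_singleton hG hvw hvw' hw hxv hyv hxy
    exact ⟨s, hs, fun e => hu (e ▸ hs.1), hne⟩

/-- reduction rule for three pairwise twins. -/
theorem resolving_iff_delete_twin [Fintype V] (G : SimpleGraph V) (hG : G.Connected)
    (u v w : V)
    (h : (TrueTwins G u v ∧ TrueTwins G u w ∧ TrueTwins G v w) ∨
         (FalseTwins G u v ∧ FalseTwins G u w ∧ FalseTwins G v w))
    (k : ℕ) (hk : 1 ≤ k) :
    (∃ S : Set V, IsResolving G S ∧ S.ncard ≤ k) ↔
      (∃ S : Set ↥({u}ᶜ : Set V), IsResolving (G.induce ({u}ᶜ : Set V)) S ∧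
        S.ncard ≤ k - 1) := by
  obtain ⟨⟨huv, huw, hvw⟩, huv', huw', hvw'⟩ :
      (SameOuterNeighbors G u v ∧ SameOuterNeighbors G u w ∧ SameOuterNeighbors G v w) ∧
        u ≠ v ∧ u ≠ w ∧ v ≠ w := by
    rcases h with ⟨h₁, h₂, h₃⟩ | ⟨h₁, h₂, h₃⟩ <;>
      exact ⟨⟨h₁.sameOuterNeighbors, h₂.sameOuterNeighbors, h₃.sameOuterNeighbors⟩,
        h₁.1, h₂.1, h₃.1⟩
  constructor
  · rintro ⟨S, hS, hcard⟩
    obtain ⟨p, hp, hres⟩ := hS.exists_induce_compl hG huv huw hvw huv' huw' hvw'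
    refine ⟨_, hres, ?_⟩
    rw [← Set.ncard_image_of_injective _ Subtype.val_injective]
    refine (Set.ncard_le_ncard (Set.image_preimage_subset _ _) (Set.toFinite _)).trans ?_
    rw [Set.ncard_sdiff_singleton_of_mem hp]
    omega
  · rintro ⟨S, hS, hcard⟩
    refine ⟨_, hS.insert_image hG huv huv', (Set.ncard_insert_le _ _).trans ?_⟩
    rw [Set.ncard_image_of_injective _ Subtype.val_injective]
    omega
end

section
/- Let G be a graph in which no three distinct vertices are pairwise true twins, and let X ⊆ V(G) be a cluster modulator of G. Then every clique of G − X has at most 2^{|X|+1} vertices. -/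
open SimpleGraph

variable {V : Type*}

/-- Two distinct vertices of a clique of `G - X` that are clones are true twins. -/
theorem IsCliqueComponent.trueTwins_of_clones {G : SimpleGraph V} {X C : Set V}
    (hC : IsCliqueComponent G X C) {u v : V} (hu : u ∈ C) (hv : v ∈ C) (hne : u ≠ v)
    (h : Clones G X u v) : TrueTwins G u v := by
  obtain ⟨-, -, hclique, hclosed⟩ := hC
  have key : ∀ {a b : V}, a ∈ C → b ∈ C → Clones G X a b →
      insert a (G.neighborSet a) ⊆ insert b (G.neighborSet b) := by
    intro a b ha hb hab w hw
    by_cases hwb : w = b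
    · exact Or.inl hwb
    right
    rcases hw with rfl | hw
    · exact hclique b hb w ha (Ne.symm hwb)
    by_cases hwX : w ∈ X
    · exact ((Set.ext_iff.mp hab w).mp ⟨hw, hwX⟩).1
    · exact hclique b hb w (hclosed a ha w hwX hw) (Ne.symm hwb)
  exact ⟨hne, (key hu hv h).antisymm (key hv hu h.symm)⟩

/-- bound on the size of each clique of `G - X`. -/
theorem clique_card_le [Fintype V] (G : SimpleGraph V) (hT : NoThreeTrueTwins G)
    (X : Set V) (hX : IsClusterModulator G X)
    (C : Set V) (hC : IsCliqueComponent G X C) :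
    C.ncard ≤ 2 ^ (X.ncard + 1) := by
  classical
  have hmaps : ∀ a ∈ C.toFinset, (G.neighborSet a ∩ X).toFinset ∈ X.toFinset.powerset := by
    intro a _
    simp
  have hfiber : ∀ S ∈ X.toFinset.powerset,
      (C.toFinset.filter fun a => (G.neighborSet a ∩ X).toFinset = S).card ≤ 2 := by
    intro S _
    by_contra! hlt
    obtain ⟨u, v, w, hu, hv, hw, huv, huw, hvw⟩ := Finset.two_lt_card_iff.mp hlt
    rw [Finset.mem_filter, Set.mem_toFinset] at hu hv hw
    have twins : ∀ {a b : V}, (a ∈ C ∧ (G.neighborSet a ∩ X).toFinset = S) →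
        (b ∈ C ∧ (G.neighborSet b ∩ X).toFinset = S) → a ≠ b → TrueTwins G a b :=
      fun ha hb hab => hC.trueTwins_of_clones ha.1 hb.1 hab
        (Set.toFinset_inj.mp (ha.2.trans hb.2.symm))
    exact hT ⟨u, v, w, twins hu hv huv, twins hu hw huw, twins hv hw hvw⟩
  have hcard := Finset.card_le_mul_card_image_of_maps_to hmaps 2 hfiber
  rwa [Finset.card_powerset, ← Set.ncard_eq_toFinset_card', ← Set.ncard_eq_toFinset_card',
    ← pow_succ'] at hcard
end

section
/- Let G be a connected graph, X a cluster modulator of G, and C1, C2 two distinct identical cliques of G − X such that there exist clones u ∈ C1 and v ∈ C2. Then every resolving set S of G satisfies S ∩ (V(C1) ∪ V(C2)) ≠ ∅. -/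
open SimpleGraph

variable {V : Type*}

/-- Folding a clique `D` of `G - X` injectively onto a clique `C`, preserving neighborhoods in `X`,
does not increase distances from vertices outside `D`. -/
lemma dist_le_of_clique_fold (G : SimpleGraph V) (hG : G.Connected) {X C D : Set V}
    (hC : IsCliqueComponent G X C) (hD : IsCliqueComponent G X D) (g : D ↪ C)
    (hg : ∀ a : D, G.neighborSet (g a : V) ∩ X = G.neighborSet (a : V) ∩ X)
    {w : V} (hw : w ∉ D) (v : D) : G.dist w (g v) ≤ G.dist w v := by
  classical
  let φ : V → V := fun x => if h : x ∈ D then g ⟨x, h⟩ else x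
  have φ_mem {x : V} (h : x ∈ D) : φ x = g ⟨x, h⟩ := dif_pos h
  have φ_notMem {x : V} (h : x ∉ D) : φ x = x := dif_neg h
  have adj_of_mem {a b : V} (ha : a ∈ D) (hb : b ∉ D) (hab : G.Adj a b) :
      G.Adj (g ⟨a, ha⟩) b := by
    have hbX : b ∈ X := by_contra fun h => hb (hD.2.2.2 a ha b h hab)
    have hmem : b ∈ G.neighborSet (g ⟨a, ha⟩ : V) ∩ X := by
      rw [hg ⟨a, ha⟩]
      exact ⟨hab, hbX⟩
    exact hmem.1
  have hφ {a b : V} (hab : G.Adj a b) : G.Adj (φ a) (φ b) := by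
    by_cases ha : a ∈ D <;> by_cases hb : b ∈ D
    · rw [φ_mem ha, φ_mem hb]
      refine hC.2.2.1 _ (g _).2 _ (g _).2 fun h => hab.ne ?_
      exact congrArg Subtype.val (g.injective (Subtype.ext h))
    · rw [φ_mem ha, φ_notMem hb]
      exact adj_of_mem ha hb hab
    · rw [φ_notMem ha, φ_mem hb]
      exact (adj_of_mem hb ha hab.symm).symm
    · rwa [φ_notMem ha, φ_notMem hb]
  obtain ⟨p, hp⟩ := hG.exists_walk_length_eq_dist w v
  have hle := dist_le (p.map (⟨φ, hφ⟩ : G →g G))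
  rw [Walk.length_map, hp] at hle
  change G.dist (φ w) (φ v) ≤ _ at hle
  rwa [φ_notMem hw, φ_mem v.2] at hle

/-- Cliques of `G - X` sharing a vertex are nested. -/
lemma IsCliqueComponent.subset_of_mem {G : SimpleGraph V} {X C D : Set V} {u : V}
    (hC : IsCliqueComponent G X C) (hD : IsCliqueComponent G X D) (huC : u ∈ C) (huD : u ∈ D) :
    C ⊆ D := by
  intro a ha
  by_cases h : u = a
  · exact h ▸ huD
  · exact hD.2.2.2 u huD a (hC.2.1 ha) (hC.2.2.1 u huC a ha h)

/-- A bijection witnessing that two cliques are identical can be chosen to match given clones. -/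
lemma Identical.exists_equiv_apply_eq {G : SimpleGraph V} {X C D : Set V}
    (hid : Identical G X C D) (u : C) (v : D) (huv : Clones G X u v) :
    ∃ f : C ≃ D, f u = v ∧
      ∀ a : C, G.neighborSet (f a : V) ∩ X = G.neighborSet (a : V) ∩ X := by
  classical
  obtain ⟨f, hf⟩ := hid
  refine ⟨f.trans (Equiv.swap (f u) v), by simp, fun a => ?_⟩
  rw [Equiv.trans_apply, ← hf a, Equiv.swap_apply_def]
  split_ifs with h₁ h₂
  · rw [h₁, hf u]
    exact huv.symm
  · rw [h₂, hf u]
    exact huv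
  · rfl

/-- every resolving set meets two identical cliques with clones. -/
theorem resolving_meets_identical_cliques [Fintype V] (G : SimpleGraph V) (hG : G.Connected)
    (X : Set V) (hX : IsClusterModulator G X)
    (C1 C2 : Set V) (hC1 : IsCliqueComponent G X C1) (hC2 : IsCliqueComponent G X C2)
    (hne : C1 ≠ C2) (hid : Identical G X C1 C2)
    (u v : V) (hu : u ∈ C1) (hv : v ∈ C2) (huv : Clones G X u v)
    (S : Set V) (hS : IsResolving G S) :
    (S ∩ (C1 ∪ C2)).Nonempty := by
  by_contra hempty
  have huv_ne : u ≠ v := by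
    rintro rfl
    exact hne ((hC1.subset_of_mem hC2 hu hv).antisymm (hC2.subset_of_mem hC1 hv hu))
  obtain ⟨w, hwS, hw⟩ := hS u v huv_ne
  have hw1 : w ∉ C1 := fun h => hempty ⟨w, hwS, Or.inl h⟩
  have hw2 : w ∉ C2 := fun h => hempty ⟨w, hwS, Or.inr h⟩
  obtain ⟨f, hfu, hf⟩ := hid.exists_equiv_apply_eq ⟨u, hu⟩ ⟨v, hv⟩ huv
  have hf_symm (a : C2) :
      G.neighborSet (f.symm a : V) ∩ X = G.neighborSet (a : V) ∩ X := by
    simpa using (hf (f.symm a)).symm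
  have hvu := dist_le_of_clique_fold G hG hC2 hC1 f.toEmbedding hf hw1 ⟨u, hu⟩
  have huv_le := dist_le_of_clique_fold G hG hC1 hC2 f.symm.toEmbedding hf_symm hw2 ⟨v, hv⟩
  rw [Equiv.toEmbedding_apply, hfu] at hvu
  rw [Equiv.toEmbedding_apply, ← hfu, Equiv.symm_apply_apply, hfu] at huv_le
  exact hw (huv_le.antisymm hvu)
end

section
/- Let G be a connected graph in which no three distinct vertices are pairwise true twins, X a cluster modulator of G, and 𝒞 an equivalence class of identical cliques of G − X with |𝒞| ≥ |X| + 2. Then for every minimum resolving set S of G, |S ∩ V(𝒞)| ≤ |X| + |𝒞| · max(1, t(𝒞)). -/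
open SimpleGraph

variable {V : Type*}

/-- A vertex of a clique of `G - X` is at distance at least two from every other vertex of
`G - X` outside that clique, so it separates the two sides. -/
theorem IsCliqueComponent.dist_ne {G : SimpleGraph V} {X C : Set V}
    (hC : IsCliqueComponent G X C) (hG : G.Connected) {w u v : V} (hw : w ∈ C) (hu : u ∈ C)
    (hvX : v ∉ X) (hv : v ∉ C) : G.dist w u ≠ G.dist w v := by
  have hwv : ¬ G.Adj w v := fun h => hv (hC.2.2.2 w hw v hvX h)
  by_cases hwu : w = u
  · subst hwu
    rw [SimpleGraph.dist_self]
    exact (hG.pos_dist_of_ne (ne_of_mem_of_not_mem hw hv)).ne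
  · rw [SimpleGraph.dist_eq_one_iff_adj.2 (hC.2.2.1 w hw u hu hwu)]
    exact fun h => hwv (SimpleGraph.dist_eq_one_iff_adj.1 h.symm)

/-- A walk leaving a clique of `G - X` meets `X`. -/
theorem IsCliqueComponent.exists_mem_support {G : SimpleGraph V} {X C : Set V}
    (hC : IsCliqueComponent G X C) {s u : V} (p : G.Walk s u) (hs : s ∈ C) (hu : u ∉ C) :
    ∃ x ∈ X, x ∈ p.support := by
  induction p with
  | nil => exact absurd hs hu
  | @cons a b c h p ih =>
    by_cases hb : b ∈ X
    · exact ⟨b, hb, by simp⟩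
    · obtain ⟨x, hx, hxp⟩ := ih (hC.2.2.2 a hs b hb h) hu
      exact ⟨x, hx, by simp [hxp]⟩

/-- A geodesic leaving a clique of `G - X` factors through `X`. -/
theorem IsCliqueComponent.exists_dist_add {G : SimpleGraph V} {X C : Set V}
    (hC : IsCliqueComponent G X C) (hG : G.Connected) {s u : V} (hs : s ∈ C) (hu : u ∉ C) :
    ∃ x ∈ X, G.dist s x + G.dist x u ≤ G.dist s u := by
  classical
  obtain ⟨p, hp⟩ := hG.exists_walk_length_eq_dist s u
  obtain ⟨x, hx, hxp⟩ := hC.exists_mem_support p hs hu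
  refine ⟨x, hx, ?_⟩
  have hlen := congrArg SimpleGraph.Walk.length (p.take_spec hxp)
  rw [SimpleGraph.Walk.length_append] at hlen
  have h₁ := SimpleGraph.dist_le (p.takeUntil x hxp)
  have h₂ := SimpleGraph.dist_le (p.dropUntil x hxp)
  omega

/-- Vertices with the same distances to `X` have the same distance to every vertex of a clique
of `G - X` containing neither of them. -/
theorem IsCliqueComponent.dist_eq_of_forall_dist_eq {G : SimpleGraph V} {X C : Set V}
    (hC : IsCliqueComponent G X C) (hG : G.Connected) {s u v : V} (hs : s ∈ C)
    (hu : u ∉ C) (hv : v ∉ C) (h : ∀ x ∈ X, G.dist x u = G.dist x v) :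
    G.dist s u = G.dist s v := by
  obtain ⟨x, hx, hxu⟩ := hC.exists_dist_add hG hs hu
  obtain ⟨y, hy, hyv⟩ := hC.exists_dist_add hG hs hv
  have h₁ := hG.dist_triangle (u := s) (v := y) (w := u)
  have h₂ := hG.dist_triangle (u := s) (v := x) (w := v)
  have h₃ := h x hx
  have h₄ := h y hy
  omega

/-- Distinct vertices of a clique of `G - X` with the same distances to `X` are true twins. -/
theorem IsCliqueComponent.trueTwins {G : SimpleGraph V} {X C : Set V}
    (hC : IsCliqueComponent G X C) {u v : V} (hu : u ∈ C) (hv : v ∈ C) (huv : u ≠ v)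
    (h : ∀ x ∈ X, G.dist x u = G.dist x v) : TrueTwins G u v := by
  have key : ∀ {u v : V}, u ∈ C → v ∈ C → (∀ x ∈ X, G.dist x u = G.dist x v) →
      insert u (G.neighborSet u) ⊆ insert v (G.neighborSet v) := by
    intro u v hu hv h a ha
    simp only [Set.mem_insert_iff, SimpleGraph.mem_neighborSet] at ha ⊢
    by_cases hav : a = v
    · exact Or.inl hav
    refine Or.inr ?_
    rcases ha with rfl | ha
    · exact hC.2.2.1 v hv a hu (Ne.symm hav)
    · by_cases haX : a ∈ X
      · have hau := h a haX
        rw [SimpleGraph.dist_eq_one_iff_adj.2 ha.symm] at hau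
        exact (SimpleGraph.dist_eq_one_iff_adj.1 hau.symm).symm
      · exact hC.2.2.1 v hv a (hC.2.2.2 u hu a haX ha) (Ne.symm hav)
  exact ⟨huv, (key hu hv h).antisymm (key hv hu fun x hx => (h x hx).symm)⟩

/-- A nonempty set `C` contains a nonempty set meeting every pair of true twins in `C` with at
most `max 1 (twinPairCount G C)` elements. -/
theorem exists_twin_transversal [Finite V] (G : SimpleGraph V) {C : Set V} (hC : C.Nonempty) :
    ∃ T ⊆ C, T.Nonempty ∧ T.ncard ≤ max 1 (twinPairCount G C) ∧
      ∀ u ∈ C, ∀ v ∈ C, TrueTwins G u v → u ∈ T ∨ v ∈ T := by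
  classical
  obtain ⟨c, hc⟩ := hC
  let P : Set (Set V) := {p | ∃ u ∈ C, ∃ v ∈ C, TrueTwins G u v ∧ p = {u, v}}
  let f : Set V → V := fun p => if h : p.Nonempty then h.some else c
  have hf : ∀ u v : V, f {u, v} = u ∨ f {u, v} = v := by
    intro u v
    have hne : ({u, v} : Set V).Nonempty := ⟨u, by simp⟩
    have hmem := hne.some_mem
    simpa [f, hne] using hmem
  by_cases hP : P.Nonempty
  · refine ⟨f '' P, ?_, hP.image f, ?_, ?_⟩
    · rintro _ ⟨_, ⟨u, hu, v, hv, -, rfl⟩, rfl⟩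
      rcases hf u v with h | h <;> rw [h] <;> assumption
    · exact (Set.ncard_image_le (Set.toFinite P)).trans (le_max_right _ _)
    · intro u hu v hv h
      have hmem : f {u, v} ∈ f '' P := ⟨_, ⟨u, hu, v, hv, h, rfl⟩, rfl⟩
      rcases hf u v with h' | h' <;> rw [h'] at hmem
      · exact Or.inl hmem
      · exact Or.inr hmem
  · refine ⟨{c}, by simpa using hc, Set.singleton_nonempty c, by simp, ?_⟩
    intro u hu v hv h
    exact absurd ⟨_, u, hu, v, hv, h, rfl⟩ hP

/-- Replacing the part of a resolving set inside a family of cliques of `G - X` by `X` and a set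
which meets each of these cliques and each pair of true twins in them is again resolving. -/
theorem IsResolving.exchange {G : SimpleGraph V} (hG : G.Connected) {X S T : Set V}
    {𝒞 : Set (Set V)} (hS : IsResolving G S) (h𝒞 : ∀ C ∈ 𝒞, IsCliqueComponent G X C)
    (hne : ∀ C ∈ 𝒞, (T ∩ C).Nonempty)
    (hT : ∀ C ∈ 𝒞, ∀ u ∈ C, ∀ v ∈ C, TrueTwins G u v → u ∈ T ∨ v ∈ T) :
    IsResolving G (S \ ⋃₀ 𝒞 ∪ X ∪ T) := by
  intro u v huv
  by_contra! hcon
  have hX : ∀ x ∈ X, G.dist x u = G.dist x v := fun x hx => hcon x (Or.inl (Or.inr hx))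
  have hT' : ∀ x ∈ T, G.dist x u = G.dist x v := fun x hx => hcon x (Or.inr hx)
  have hself : G.dist u u ≠ G.dist u v := by
    rw [SimpleGraph.dist_self]; exact (hG.pos_dist_of_ne huv).ne
  have hself' : G.dist v u ≠ G.dist v v := by
    rw [SimpleGraph.dist_self]; exact (hG.pos_dist_of_ne huv.symm).ne'
  have huX : u ∉ X := fun h => hself (hX u h)
  have hvX : v ∉ X := fun h => hself' (hX v h)
  have hmem : ∀ C ∈ 𝒞, u ∉ C ∧ v ∉ C := by
    intro C hC
    obtain ⟨w, hwT, hwC⟩ := hne C hC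
    by_cases hu : u ∈ C <;> by_cases hv : v ∈ C
    · rcases hT C hC u hu v hv ((h𝒞 C hC).trueTwins hu hv huv hX) with h | h
      · exact absurd (hT' u h) hself
      · exact absurd (hT' v h) hself'
    · exact absurd (hT' w hwT) ((h𝒞 C hC).dist_ne hG hwC hu hvX hv)
    · exact absurd (hT' w hwT).symm ((h𝒞 C hC).dist_ne hG hwC hv huX hu)
    · exact ⟨hu, hv⟩
  obtain ⟨s, hs, hne'⟩ := hS u v huv
  by_cases hs𝒞 : s ∈ ⋃₀ 𝒞
  · obtain ⟨C, hC, hsC⟩ := hs𝒞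
    exact hne' ((h𝒞 C hC).dist_eq_of_forall_dist_eq hG hsC (hmem C hC).1 (hmem C hC).2 hX)
  · exact hne' (hcon s (Or.inl (Or.inl ⟨hs, hs𝒞⟩)))

/-- upper bound on the intersection of a minimum resolving set with `V(𝒞)`. -/
theorem min_resolving_inter_class_upper [Fintype V] (G : SimpleGraph V) (hG : G.Connected)
    (hT : NoThreeTrueTwins G) (X : Set V) (hX : IsClusterModulator G X)
    (𝒞 : Set (Set V)) (h𝒞 : IsIdenticalClass G X 𝒞)
    (t : ℕ) (ht : ∀ C ∈ 𝒞, twinPairCount G C = t)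
    (hcard : X.ncard + 2 ≤ 𝒞.ncard)
    (S : Set V) (hS : IsResolving G S)
    (hmin : ∀ T : Set V, IsResolving G T → S.ncard ≤ T.ncard) :
    (S ∩ ⋃₀ 𝒞).ncard ≤ X.ncard + 𝒞.ncard * max 1 t := by
  classical
  have hex : ∀ C ∈ 𝒞, ∃ T ⊆ C, T.Nonempty ∧ T.ncard ≤ max 1 t ∧
      ∀ u ∈ C, ∀ v ∈ C, TrueTwins G u v → u ∈ T ∨ v ∈ T := by
    intro C hC
    rw [← ht C hC]
    exact exists_twin_transversal G (h𝒞.1 C hC).1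
  choose! T hTC hTne hTcard hTtwin using hex
  have hres : IsResolving G (S \ ⋃₀ 𝒞 ∪ X ∪ ⋃ C ∈ 𝒞, T C) := by
    refine hS.exchange hG h𝒞.1 ?_ ?_
    · intro C hC
      obtain ⟨w, hw⟩ := hTne C hC
      exact ⟨w, Set.mem_biUnion hC hw, hTC C hC hw⟩
    · intro C hC u hu v hv h
      exact (hTtwin C hC u hu v hv h).imp (Set.mem_biUnion hC) (Set.mem_biUnion hC)
  have hTle : (⋃ C ∈ 𝒞, T C).ncard ≤ 𝒞.ncard * max 1 t := by
    have hcoe : (⋃ C ∈ 𝒞, T C) = ↑(𝒞.toFinset.biUnion fun C => (T C).toFinset) := by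
      ext; simp
    rw [hcoe, Set.ncard_coe_finset, Set.ncard_eq_toFinset_card' 𝒞]
    refine Finset.card_biUnion_le_card_mul _ _ _ fun C hC => ?_
    rw [← Set.ncard_eq_toFinset_card']
    exact hTcard C (by simpa using hC)
  have hle := hmin _ hres
  have h₁ := Set.ncard_union_le (S \ ⋃₀ 𝒞 ∪ X) (⋃ C ∈ 𝒞, T C)
  have h₂ := Set.ncard_union_le (S \ ⋃₀ 𝒞) X
  have h₃ := Set.ncard_inter_add_ncard_sdiff_eq_ncard S (⋃₀ 𝒞) (Set.toFinite S)
  omega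
end

section
/- Let G be a graph, X a cluster modulator of G, and C a clique of G − X. Then two distinct vertices u, v ∈ C are true twins of G if and only if N(u) ∩ X = N(v) ∩ X. Consequently, if C1 and C2 are identical cliques of G − X, then the number of unordered pairs of true twins of G contained in C1 equals the number of unordered pairs of true twins of G contained in C2. -/
open SimpleGraph

variable {V : Type*}

theorem IsCliqueComponent.trueTwins_iff {G : SimpleGraph V} {X C : Set V}
    (hC : IsCliqueComponent G X C) {u v : V} (hu : u ∈ C) (hv : v ∈ C) (huv : u ≠ v) :
    TrueTwins G u v ↔ G.neighborSet u ∩ X = G.neighborSet v ∩ X := by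
  obtain ⟨-, hCX, hadj, hmax⟩ := hC
  have hout : ∀ a ∈ C, ∀ b ∈ C, ∀ w ∉ X, G.Adj a w → w = b ∨ G.Adj b w := by
    intro a ha b hb w hw haw
    by_cases hwb : w = b
    · exact Or.inl hwb
    · exact Or.inr (hadj b hb w (hmax a ha w hw haw) (Ne.symm hwb))
  have hne : ∀ a ∈ C, ∀ w ∈ X, w ≠ a := fun a ha w hw h => hCX ha (h ▸ hw)
  simp only [TrueTwins, Set.ext_iff, Set.mem_insert_iff, Set.mem_inter_iff, mem_neighborSet]
  constructor
  · rintro ⟨-, h⟩ w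
    refine and_congr_left fun hw => ?_
    simpa [hne u hu w hw, hne v hv w hw] using h w
  · refine fun h => ⟨huv, fun w => ?_⟩
    by_cases hw : w ∈ X
    · have := h w
      simp only [hw, and_true] at this
      simp [hne u hu w hw, hne v hv w hw, this]
    · constructor
      · rintro (rfl | hw')
        · exact Or.inr (hadj v hv w hu (Ne.symm huv))
        · exact hout u hu v hv w hw hw'
      · rintro (rfl | hw')
        · exact Or.inr (hadj u hu w hv huv)
        · exact hout v hv u hu w hw hw'

theorem Identical.symm {G : SimpleGraph V} {X C₁ C₂ : Set V} (h : Identical G X C₁ C₂) :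
    Identical G X C₂ C₁ := by
  obtain ⟨f, hf⟩ := h
  exact ⟨f.symm, fun u => by simpa using (hf (f.symm u)).symm⟩

theorem Identical.twinPairCount_le [Finite V] {G : SimpleGraph V} {X C₁ C₂ : Set V}
    (h : Identical G X C₁ C₂) (h₁ : IsCliqueComponent G X C₁) (h₂ : IsCliqueComponent G X C₂) :
    twinPairCount G C₁ ≤ twinPairCount G C₂ := by
  obtain ⟨f, hf⟩ := h
  refine Set.ncard_le_ncard_of_injOn
    (fun p => Subtype.val '' (f '' (Subtype.val ⁻¹' p))) ?_ ?_ (Set.toFinite _)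
  · rintro _ ⟨u, hu, v, hv, huv, rfl⟩
    have hne : (f ⟨u, hu⟩ : V) ≠ f ⟨v, hv⟩ := by
      simpa [Subtype.val_inj] using huv.1
    refine ⟨f ⟨u, hu⟩, (f _).2, f ⟨v, hv⟩, (f _).2, ?_, ?_⟩
    · rw [h₂.trueTwins_iff (f _).2 (f _).2 hne, hf, hf]
      exact (h₁.trueTwins_iff hu hv huv.1).1 huv
    · have hpre : (Subtype.val ⁻¹' {u, v} : Set C₁) = {⟨u, hu⟩, ⟨v, hv⟩} := by
        ext x
        simp [Subtype.ext_iff]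
      simp only [hpre, Set.image_pair]
  · have hsub : ∀ p ∈ {p : Set V | ∃ u ∈ C₁, ∃ v ∈ C₁, TrueTwins G u v ∧ p = {u, v}},
        p ⊆ Set.range (Subtype.val : C₁ → V) := by
      rintro _ ⟨u, hu, v, hv, -, rfl⟩
      simp [Set.pair_subset_iff, hu, hv]
    intro p hp q hq hpq
    exact (Set.preimage_eq_preimage' (hsub p hp) (hsub q hq)).1
      (f.injective.image_injective (Subtype.val_injective.image_injective hpq))

/-- inside a clique of `G - X`, being true twins is equivalent to being
clones; hence identical cliques have the same number of true-twin pairs. -/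
theorem trueTwins_iff_clones_and_twin_count [Fintype V] (G : SimpleGraph V)
    (X : Set V) (hX : IsClusterModulator G X) :
    (∀ C : Set V, IsCliqueComponent G X C → ∀ u ∈ C, ∀ v ∈ C, u ≠ v →
      (TrueTwins G u v ↔ G.neighborSet u ∩ X = G.neighborSet v ∩ X)) ∧
    (∀ C1 C2 : Set V, IsCliqueComponent G X C1 → IsCliqueComponent G X C2 →
      Identical G X C1 C2 → twinPairCount G C1 = twinPairCount G C2) := by
  refine ⟨fun C hC u hu v hv huv => hC.trueTwins_iff hu hv huv, fun C1 C2 h₁ h₂ h => ?_⟩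
  exact (h.twinPairCount_le h₁ h₂).antisymm (h.symm.twinPairCount_le h₂ h₁)
end

section
/- Let G be a connected graph, let u, v, w be three distinct vertices of G, and let A ⊆ V(G) \ {u, v, w} be a set such that every path in G from w to u contains a vertex of A and every path in G from w to v contains a vertex of A. If d(a, u) = d(a, v) for every a ∈ A, then d(w, u) = d(w, v). -/
open SimpleGraph

variable {V : Type*}

/-- If every path from `w` to `u` meets a set of vertices whose distances to `v` are the same as
their distances to `u`, then `w` is at most as far from `v` as from `u`. -/
theorem dist_le_dist_of_separator (G : SimpleGraph V) (hG : G.Connected) (u v w : V) (A : Set V)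
    (hsep : ∀ p : G.Walk w u, p.IsPath → ∃ a ∈ A, a ∈ p.support)
    (hd : ∀ a ∈ A, G.dist a v = G.dist a u) :
    G.dist w v ≤ G.dist w u := by
  classical
  obtain ⟨p, hp, hlen⟩ := hG.exists_path_of_dist w u
  obtain ⟨a, ha, hap⟩ := hsep p hp
  calc G.dist w v ≤ G.dist w a + G.dist a v := hG.dist_triangle
    _ = G.dist w a + G.dist a u := by rw [hd a ha]
    _ ≤ (p.takeUntil a hap).length + (p.dropUntil a hap).length :=
      add_le_add (dist_le _) (dist_le _)
    _ = G.dist w u := by rw [← Walk.length_append, Walk.take_spec, hlen]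

/-- if every path from `w` to `u` and to `v` crosses a set `A` of
vertices equidistant from `u` and `v`, then `w` is equidistant from `u` and `v`. -/
theorem separator_equidistant [Fintype V] (G : SimpleGraph V) (hG : G.Connected)
    (u v w : V) (huv : u ≠ v) (huw : u ≠ w) (hvw : v ≠ w)
    (A : Set V) (hA : A ⊆ ({u, v, w} : Set V)ᶜ)
    (hsepu : ∀ p : G.Walk w u, p.IsPath → ∃ a ∈ A, a ∈ p.support)
    (hsepv : ∀ p : G.Walk w v, p.IsPath → ∃ a ∈ A, a ∈ p.support)
    (hd : ∀ a ∈ A, G.dist a u = G.dist a v) :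
    G.dist w u = G.dist w v := by
  exact le_antisymm (dist_le_dist_of_separator G hG v u w A hsepv hd)
    (dist_le_dist_of_separator G hG u v w A hsepu fun a ha => (hd a ha).symm)
end

section
/- Let G be a graph in which no three distinct vertices are pairwise false twins, and let X ⊆ V(G) be a set such that G − X is a co-cluster graph, i.e., the complement of the induced subgraph G − X is a disjoint union of cliques. Then every independent set of G − X that corresponds to a connected component of the complement of G − X has at most 2^{|X|+1} vertices. -/
open SimpleGraph

variable {V : Type*}

/-- Vertices of a co-component with the same neighborhood in `X` have the same neighborhood. -/
theorem IsCoComponent.neighborSet_eq {G : SimpleGraph V} {X I : Set V} (hI : IsCoComponent G X I)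
    {u v : V} (hu : u ∈ I) (hv : v ∈ I)
    (h : G.neighborSet u ∩ X = G.neighborSet v ∩ X) : G.neighborSet u = G.neighborSet v := by
  obtain ⟨-, -, hind, hmax⟩ := hI
  have key : ∀ a ∈ I, ∀ b ∈ I, G.neighborSet a ∩ X = G.neighborSet b ∩ X →
      G.neighborSet a ⊆ G.neighborSet b := by
    intro a ha b hb hab w haw
    by_cases hw : w ∈ X
    · exact (hab.subset ⟨haw, hw⟩).1
    · by_contra hbw
      have hwI : w ∈ I := by
        by_cases hbe : b = w
        · exact hbe ▸ hb
        · exact hmax b hb w hw hbe hbw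
      exact hind a ha w hwI (G.ne_of_adj haw) haw
  exact (key u hu v hv h).antisymm (key v hv u hu h.symm)

/-- bound on the size of each independent set (component of the
complement) of the co-cluster graph `G - X`. -/
theorem cocluster_component_card_le [Fintype V] (G : SimpleGraph V)
    (hT : NoThreeFalseTwins G)
    (X : Set V) (hX : IsClusterGraph ((G.induce (Xᶜ : Set V))ᶜ))
    (I : Set V) (hI : IsCoComponent G X I) :
    I.ncard ≤ 2 ^ (X.ncard + 1) := by
  classical
  rw [Set.ncard_eq_toFinset_card' I, Set.ncard_eq_toFinset_card' X, pow_succ',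
    ← Finset.card_powerset]
  refine Finset.card_le_mul_card_image_of_maps_to
    (f := fun v => (G.neighborSet v ∩ X).toFinset) (fun v _ => ?_) 2 fun S _ => ?_
  · rw [Finset.mem_powerset, Set.toFinset_subset_toFinset]
    exact Set.inter_subset_right
  · by_contra! hcard
    obtain ⟨u, v, w, hu, hv, hw, huv, huw, hvw⟩ := Finset.two_lt_card_iff.mp hcard
    simp only [Finset.mem_filter, Set.mem_toFinset] at hu hv hw
    have twins : ∀ {a b : V}, a ∈ I ∧ (G.neighborSet a ∩ X).toFinset = S →
        b ∈ I ∧ (G.neighborSet b ∩ X).toFinset = S → a ≠ b → FalseTwins G a b :=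
      fun ha hb hab => ⟨hab, hI.neighborSet_eq ha.1 hb.1
        (Set.toFinset_inj.mp (ha.2.trans hb.2.symm))⟩
    exact hT ⟨u, v, w, twins hu hv huv, twins hu hw huw, twins hv hw hvw⟩
end
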